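/- Let (X,d) be a metric space, T : X → X a continuous map, μ a T-invariant ergodic Borel probability measure, and 𝒜 a finite measurable partition of X with μ(∂A) = 0 for every A ∈ 𝒜. Then for every δ > 0 there exist N ∈ ℕ, ε₁ > 0, and a measurable set D_N ⊆ X with μ(D_N) > 1 − δ, such that for every 0 < ε < ε₁, every x ∈ D_N and every n ≥ N, the number of n-cylinders intersecting the Bowen ball satisfies |{A ∈ 𝒜^n : A ∩ B_{ε,n}(x) ≠ ∅}| ≤ e^{δn}. -/

import Mathlib

open MeasureTheory Filter Set Metric Topology ENNReal

/-- The `(ε,n)`-Bowen ball `B_{ε,n}(x)`. -/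
def bowenBall {X : Type*} [PseudoMetricSpace X] (T : X → X) (ε : ℝ) (n : ℕ) (x : X) : Set X :=
  {y | ∀ k < n, dist (T^[k] x) (T^[k] y) < ε}

/-- `W_{A,m}(x)`, the number of visits of the orbit `Tx, …, T^m x` to `A`. -/
noncomputable def visits {X : Type*} (T : X → X) (A : Set X) (m : ℕ) (x : X) : ℕ :=
  ∑ j ∈ Finset.Icc 1 m, A.indicator (fun _ => 1) (T^[j] x)

/-- The first hitting time `τ_A(x) = min {k ≥ 1 : T^k x ∈ A}` (junk value `0` if no hit). -/
noncomputable def hitTime {X : Type*} (T : X → X) (A : Set X) (x : X) : ℕ :=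
  sInf {k | 1 ≤ k ∧ T^[k] x ∈ A}

/-- The set `{τ_A ≤ Δ}` of points hitting `A` at some time `1 ≤ k ≤ Δ`. -/
def hitBefore {X : Type*} (T : X → X) (A : Set X) (Δ : ℕ) : Set X :=
  {x | ∃ k, 1 ≤ k ∧ k ≤ Δ ∧ T^[k] x ∈ A}

/-- The period `τ(A) = min {k ≥ 1 : T^{-k}A ∩ A ≠ ∅}` (junk value `0` if no return). -/
noncomputable def period {X : Type*} (T : X → X) (A : Set X) : ℕ :=
  sInf {k | 1 ≤ k ∧ (A ∩ T^[k] ⁻¹' A).Nonempty}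

/-- The `n`-cylinder `A_n(x)` of the partition `𝒜`: the set of points whose
`𝒜`-itinerary of length `n` agrees with that of `x`. -/
def cylinder {X : Type*} (T : X → X) (𝒜 : Set (Set X)) (n : ℕ) (x : X) : Set X :=
  {y | ∀ j < n, ∀ A ∈ 𝒜, (T^[j] x ∈ A ↔ T^[j] y ∈ A)}

/-- The elements of the `n`-th join `𝒜^n = ⋁_{j=0}^{n-1} T^{-j}𝒜` (the `n`-cylinders). -/
def joinCyl {X : Type*} (T : X → X) (𝒜 : Set (Set X)) (n : ℕ) : Set (Set X) :=
  {S | ∃ ω : Fin n → Set X, (∀ j, ω j ∈ 𝒜) ∧ S = ⋂ j : Fin n, T^[(j : ℕ)] ⁻¹' ω j}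

/-- `diam (𝒜^n)`, the supremum of the diameters of the `n`-cylinders. -/
noncomputable def joinDiam {X : Type*} [PseudoMetricSpace X] (T : X → X) (𝒜 : Set (Set X))
    (n : ℕ) : ℝ :=
  ⨆ x : X, Metric.diam (cylinder T 𝒜 n x)

/-- `ψ(ε,δ,x)`: the proportion of the measure of the annulus
`B(x,ε+δ) ∖ B(x,ε-δ)` to that of the ball `B(x,ε)`. -/
noncomputable def psiReg {X : Type*} [PseudoMetricSpace X] [MeasurableSpace X]
    (μ : Measure X) (ε δ : ℝ) (x : X) : ℝ :=
  ((μ (ball x (ε + δ))).toReal - (μ (ball x (ε - δ))).toReal) / (μ (ball x ε)).toReal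

/-- `μ` is `φ`-mixing w.r.t. the partition `𝒜`. -/
def phiMixing {X : Type*} [MeasurableSpace X] (μ : Measure X) (T : X → X)
    (𝒜 : Set (Set X)) (φ : ℕ → ℝ) : Prop :=
  ∀ n k : ℕ, ∀ A B : Set X,
    MeasurableSet[MeasurableSpace.generateFrom (joinCyl T 𝒜 n)] A →
    MeasurableSet[MeasurableSpace.generateFrom (⋃ j, joinCyl T 𝒜 j)] B →
    |(μ (A ∩ T^[n + k] ⁻¹' B)).toReal - (μ A).toReal * (μ B).toReal| ≤ φ k * (μ B).toReal

/-- `μ` is `α`-mixing w.r.t. the partition `𝒜`. -/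
def alphaMixing {X : Type*} [MeasurableSpace X] (μ : Measure X) (T : X → X)
    (𝒜 : Set (Set X)) (α : ℕ → ℝ) : Prop :=
  ∀ n k : ℕ, ∀ A B : Set X,
    MeasurableSet[MeasurableSpace.generateFrom (joinCyl T 𝒜 n)] A →
    MeasurableSet[MeasurableSpace.generateFrom (⋃ j, joinCyl T 𝒜 j)] B →
    |(μ (A ∩ T^[n + k] ⁻¹' B)).toReal - (μ A).toReal * (μ B).toReal| ≤ α k

/-- `ν_t({k}) = e^{-t} t^k / k!`, the Poisson weight. -/
noncomputable def poissonPM (t : ℝ) (k : ℕ) : ℝ := Real.exp (-t) * t ^ k / (Nat.factorial k)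

/-- `ν_t(E)`, the Poisson measure of a set `E ⊆ ℕ₀`. -/
noncomputable def poissonMeas (t : ℝ) (E : Set ℕ) : ℝ := ∑' k : E, poissonPM t (k : ℕ)

/-- Running maximum of Birkhoff sums, defined recursively. -/
noncomputable def maxBirk {X : Type*} (T : X → X) (f : X → ℝ) : ℕ → X → ℝ
  | 0 => fun _ => 0
  | (n + 1) => fun x => max 0 (f x + maxBirk T f n (T x))

theorem maxBirk_nonneg {X : Type*} (T : X → X) (f : X → ℝ) (n : ℕ) (x : X) :
    0 ≤ maxBirk T f n x := by
  cases n with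
  | zero => exact le_rfl
  | succ n => exact le_max_left _ _

theorem maxBirk_le_succ {X : Type*} (T : X → X) (f : X → ℝ) (n : ℕ) :
    ∀ x : X, maxBirk T f n x ≤ maxBirk T f (n + 1) x := by
  induction n with
  | zero => intro x; exact le_max_left _ _
  | succ n ih =>
    intro x
    exact max_le_max le_rfl (by linarith [ih (T x)])

theorem birk_le_maxBirk {X : Type*} (T : X → X) (f : X → ℝ) (n : ℕ) :
    ∀ x : X, ∑ k ∈ Finset.range n, f (T^[k] x) ≤ maxBirk T f n x := by
  induction n with
  | zero => intro x; simp [maxBirk]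
  | succ n ih =>
    intro x
    refine le_trans ?_ (le_max_right _ _)
    rw [Finset.sum_range_succ']
    have := ih (T x)
    simp only [Function.iterate_succ_apply, Function.iterate_zero, id]
    linarith

theorem maxBirk_integrable {X : Type*} [MeasurableSpace X] {μ : Measure X} {T : X → X}
    (hT : MeasurePreserving T μ μ) {f : X → ℝ} (hf : Integrable f μ) (n : ℕ) :
    Integrable (maxBirk T f n) μ := by
  induction n with
  | zero => exact integrable_zero _ _ _
  | succ n ih =>
    have h1 : Integrable (fun x => maxBirk T f n (T x)) μ := hT.integrable_comp_of_integrable ih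
    exact (integrable_zero X ℝ μ).sup (hf.add h1)

theorem maxBirk_measurable {X : Type*} [MeasurableSpace X] {T : X → X}
    (hT : Measurable T) {f : X → ℝ} (hf : Measurable f) (n : ℕ) :
    Measurable (maxBirk T f n) := by
  induction n with
  | zero => exact measurable_const
  | succ n ih => exact measurable_const.max (hf.add (ih.comp hT))

/-- The maximal ergodic theorem. -/
theorem maximal_ergodic {X : Type*} [MeasurableSpace X] {μ : Measure X} {T : X → X}
    (hT : MeasurePreserving T μ μ) {f : X → ℝ} (hfm : Measurable f) (hf : Integrable f μ) (n : ℕ) :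
    0 ≤ ∫ x in {x | 0 < maxBirk T f n x}, f x ∂μ := by
  have hE : MeasurableSet {x | 0 < maxBirk T f n x} :=
    measurableSet_lt measurable_const (maxBirk_measurable hT.measurable hfm n)
  rw [← integral_indicator hE]
  have hi := maxBirk_integrable hT hf n
  have hi2 : Integrable (fun x => maxBirk T f n (T x)) μ := hT.integrable_comp_of_integrable hi
  have h0 : ∫ x, (maxBirk T f n x - maxBirk T f n (T x)) ∂μ = 0 := by
    rw [integral_sub hi hi2, sub_eq_zero]
    have h := integral_map (μ := μ) (φ := T) hT.measurable.aemeasurable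
      (f := maxBirk T f n) (by rw [hT.map_eq]; exact hi.aestronglyMeasurable)
    rw [hT.map_eq] at h
    exact h
  refine h0.symm.le.trans ?_
  refine integral_mono (hi.sub hi2) (hf.indicator hE) ?_
  intro x
  by_cases hx : 0 < maxBirk T f n x
  · rw [Set.indicator_of_mem (by exact hx)]
    cases n with
    | zero => exact absurd hx (lt_irrefl _)
    | succ n =>
      have h1 := maxBirk_le_succ T f n (T x)
      have h2 : maxBirk T f (n + 1) x = max 0 (f x + maxBirk T f n (T x)) := rfl
      have h3 : maxBirk T f (n + 1) x = f x + maxBirk T f n (T x) := by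
        rw [h2] at hx ⊢
        rcases lt_max_iff.1 hx with h | h
        · exact absurd h (lt_irrefl _)
        · exact max_eq_right h.le
      show maxBirk T f (n + 1) x - maxBirk T f (n + 1) (T x) ≤ f x
      linarith
  · rw [Set.indicator_of_notMem (by exact hx)]
    show maxBirk T f n x - maxBirk T f n (T x) ≤ 0
    linarith [maxBirk_nonneg T f n (T x), not_lt.1 hx]

/-- Weak type maximal inequality for visits to `U`. -/
theorem exists_good_set {X : Type*} [MeasurableSpace X] {μ : Measure X} [IsProbabilityMeasure μ]
    {T : X → X} (hT : MeasurePreserving T μ μ) {U : Set X} (hU : MeasurableSet U)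
    {η δ : ℝ} (hη : 0 < η) (hUδ : μ.real U < δ * η) :
    ∃ D : Set X, MeasurableSet D ∧ 1 - δ < (μ D).toReal ∧ ∀ x ∈ D, ∀ n : ℕ,
      ∑ k ∈ Finset.range n, U.indicator (fun _ => (1 : ℝ)) (T^[k] x) ≤ η * n := by
  set g : X → ℝ := U.indicator (fun _ => (1 : ℝ)) with hg
  set f : X → ℝ := fun x => g x - η with hfdef
  have hgm : Measurable g := measurable_const.indicator hU
  have hgi : Integrable g μ := (integrable_const (1 : ℝ)).indicator hU
  have hfm : Measurable f := hgm.sub_const η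
  have hfi : Integrable f μ := hgi.sub (integrable_const η)
  have hEm : ∀ n, MeasurableSet {x | 0 < maxBirk T f n x} := fun n =>
    measurableSet_lt measurable_const (maxBirk_measurable hT.measurable hfm n)
  have hbound : ∀ n, μ.real {x | 0 < maxBirk T f n x} ≤ μ.real U / η := by
    intro n
    have h := maximal_ergodic hT hfm hfi n
    rw [hfdef, integral_sub hgi.integrableOn (integrable_const η).integrableOn] at h
    have h1 : ∫ x in {x | 0 < maxBirk T f n x}, g x ∂μ ≤ ∫ x, g x ∂μ :=
      setIntegral_le_integral hgi (Eventually.of_forall fun x =>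
        Set.indicator_nonneg (fun _ _ => zero_le_one) x)
    have h2 : ∫ x, g x ∂μ = μ.real U := by
      rw [hg, integral_indicator_const _ hU]; simp
    rw [setIntegral_const, smul_eq_mul] at h
    rw [le_div_iff₀ hη]
    have h3 : f = fun x => g x - η := rfl
    rw [h3] at h1 ⊢
    linarith
  have hmono : Monotone fun n => {x | 0 < maxBirk T f n x} :=
    monotone_nat_of_le_succ fun n x hx => lt_of_lt_of_le hx (maxBirk_le_succ T f n x)
  have hlim : Tendsto (fun n => μ.real {x | 0 < maxBirk T f n x}) atTop
      (𝓝 (μ.real (⋃ n, {x | 0 < maxBirk T f n x}))) :=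
    (ENNReal.tendsto_toReal (measure_ne_top _ _)).comp (tendsto_measure_iUnion_atTop hmono)
  have hE : μ.real (⋃ n, {x | 0 < maxBirk T f n x}) ≤ μ.real U / η :=
    le_of_tendsto' hlim hbound
  have hlt : μ.real U / η < δ := by rwa [div_lt_iff₀ hη]
  refine ⟨(⋃ n, {x | 0 < maxBirk T f n x})ᶜ, (MeasurableSet.iUnion hEm).compl, ?_, ?_⟩
  · have := probReal_compl_eq_one_sub (μ := μ) (MeasurableSet.iUnion hEm)
    change 1 - δ < μ.real _
    rw [this]; linarith
  · intro x hx n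
    simp only [Set.mem_compl_iff, Set.mem_iUnion, not_exists, Set.mem_setOf_eq, not_lt] at hx
    have h1 := (birk_le_maxBirk T f n x).trans (hx n)
    simp only [hfdef, Finset.sum_sub_distrib, Finset.sum_const, Finset.card_range,
      nsmul_eq_mul] at h1
    linarith

/-- Points whose `ε`-ball is contained in no partition element. -/
def badSet {X : Type*} [PseudoMetricSpace X] (𝒜 : Set (Set X)) (ε : ℝ) : Set X :=
  ⋂ A ∈ 𝒜, Metric.thickening ε Aᶜ

theorem exists_badSet_small {X : Type*} [MetricSpace X] [MeasurableSpace X] [BorelSpace X]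
    (μ : Measure X) [IsProbabilityMeasure μ]
    (𝒜 : Set (Set X)) (hfin : 𝒜.Finite)
    (hpart : ∀ x : X, ∃! A, A ∈ 𝒜 ∧ x ∈ A)
    (hbd : ∀ A ∈ 𝒜, μ (frontier A) = 0) {c : ℝ} (hc : 0 < c) :
    ∃ ε > (0 : ℝ), MeasurableSet (badSet 𝒜 ε) ∧ μ.real (badSet 𝒜 ε) < c := by
  have hm : ∀ ε, MeasurableSet (badSet 𝒜 ε) := fun ε =>
    hfin.measurableSet_biInter fun A _ => Metric.isOpen_thickening.measurableSet
  let e : ℕ → ℝ := fun n => 1 / ((n : ℝ) + 1)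
  have hnull : μ (⋂ n, badSet 𝒜 (e n)) = 0 := by
    refine measure_mono_null (t := ⋃ A ∈ 𝒜, frontier A) ?_ ?_
    · intro x hx
      obtain ⟨A, ⟨hA, hxA⟩, -⟩ := hpart x
      refine Set.mem_biUnion hA ?_
      rw [← frontier_compl]
      refine ⟨?_, fun h => interior_subset h hxA⟩
      rw [Metric.mem_closure_iff]
      intro r hr
      obtain ⟨n, hn⟩ := exists_nat_one_div_lt hr
      have h1 := Set.mem_iInter₂.1 (Set.mem_iInter.1 hx n) A hA
      obtain ⟨z, hz, hd⟩ := Metric.mem_thickening_iff.1 h1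
      exact ⟨z, hz, hd.trans hn⟩
    · exact (measure_biUnion_null_iff hfin.countable).2 hbd
  have hanti : Antitone fun n => badSet 𝒜 (e n) := by
    intro m n hmn
    refine Set.iInter₂_mono fun A _ => Metric.thickening_mono ?_ _
    exact Nat.one_div_le_one_div hmn
  have hlim : Tendsto (fun n => μ.real (badSet 𝒜 (e n))) atTop (𝓝 0) := by
    have h := tendsto_measure_iInter_atTop (μ := μ) (fun n => (hm (e n)).nullMeasurableSet) hanti
      ⟨0, measure_ne_top _ _⟩
    rw [hnull] at h
    exact (ENNReal.tendsto_toReal zero_ne_top).comp h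
  obtain ⟨n, hn⟩ := (hlim.eventually (gt_mem_nhds hc)).exists
  exact ⟨e n, by positivity, hm _, hn⟩

open Classical in
theorem count_bound {X : Type*} [MetricSpace X] (T : X → X) (𝒜 : Set (Set X)) (hfin : 𝒜.Finite)
    (hpart : ∀ x : X, ∃! A, A ∈ 𝒜 ∧ x ∈ A) {ε ε₁ : ℝ} (hε : ε < ε₁) (x : X) (n : ℕ) :
    (({A ∈ joinCyl T 𝒜 n | (A ∩ bowenBall T ε n x).Nonempty}).ncard : ℝ) ≤
      Real.exp (Real.log hfin.toFinset.card * ∑ k ∈ Finset.range n,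
        (badSet 𝒜 ε₁).indicator (fun _ => (1 : ℝ)) (T^[k] x)) := by
  choose P hP hPu using hpart
  have hcard : 0 < hfin.toFinset.card :=
    Finset.card_pos.2 ⟨P x, hfin.mem_toFinset.2 (hP x).1⟩
  let t : Fin n → Finset (Set X) := fun k =>
    if T^[(k : ℕ)] x ∈ badSet 𝒜 ε₁ then hfin.toFinset else {P (T^[(k : ℕ)] x)}
  have hsub : {A ∈ joinCyl T 𝒜 n | (A ∩ bowenBall T ε n x).Nonempty} ⊆
      (((Fintype.piFinset t).image
        (fun ω => ⋂ j : Fin n, T^[(j : ℕ)] ⁻¹' ω j) : Finset (Set X)) : Set (Set X)) := by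
    rintro S ⟨⟨ω, hω, rfl⟩, y, hy, hyB⟩
    rw [Finset.mem_coe, Finset.mem_image]
    refine ⟨ω, Fintype.mem_piFinset.2 fun k => ?_, rfl⟩
    have hyk : T^[(k : ℕ)] y ∈ ω k := Set.mem_iInter.1 hy k
    by_cases hb : T^[(k : ℕ)] x ∈ badSet 𝒜 ε₁
    · simp only [t, if_pos hb]
      exact hfin.mem_toFinset.2 (hω k)
    · simp only [t, if_neg hb, Finset.mem_singleton]
      have hd := (hyB k k.2).trans hε
      have hpos : 0 < ε₁ := dist_nonneg.trans_lt hd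
      simp only [badSet, Set.mem_iInter, not_forall] at hb
      obtain ⟨A, hA, hbA⟩ := hb
      rw [Metric.mem_thickening_iff] at hbA
      push Not at hbA
      have key : ∀ z, dist (T^[(k : ℕ)] x) z < ε₁ → z ∈ A := fun z hz => by
        by_contra hzA
        exact absurd hz (not_lt.2 (hbA z hzA))
      have h1 := hPu _ A ⟨hA, key _ (by rwa [dist_self])⟩
      have h2 := hPu _ A ⟨hA, key _ hd⟩
      have h3 := hPu _ (ω k) ⟨hω k, hyk⟩
      rw [h3, ← h2, h1]
  have h1 := (Set.ncard_le_ncard hsub (Finset.finite_toSet _))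
  rw [Set.ncard_coe_finset] at h1
  have h2 := h1.trans Finset.card_image_le
  rw [Fintype.card_piFinset] at h2
  have h3 : (({A ∈ joinCyl T 𝒜 n | (A ∩ bowenBall T ε n x).Nonempty}).ncard : ℝ) ≤
    ∏ k : Fin n, ((t k).card : ℝ) := by exact_mod_cast h2
  refine h3.trans ?_
  rw [Finset.mul_sum, Real.exp_sum, Finset.prod_range]
  refine Finset.prod_le_prod (fun _ _ => Nat.cast_nonneg _) fun k _ => ?_
  by_cases hb : T^[(k : ℕ)] x ∈ badSet 𝒜 ε₁
  · simp only [t, if_pos hb, Set.indicator_of_mem hb, mul_one]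
    rw [Real.exp_log (by exact_mod_cast hcard)]
  · simp [t, if_neg hb, Set.indicator_of_notMem hb]

/-- **Lemma (Brin–Katok cluster lemma).** For an ergodic measure and a finite partition
with null boundaries, the number of `n`-cylinders meeting `B_{ε,n}(x)` is at most `e^{δn}`
for all `x` in a set of measure `> 1-δ`, all small `ε` and all large `n`. -/
theorem card_cylinders_meeting_bowen_ball_le
    {X : Type*} [MetricSpace X] [MeasurableSpace X] [BorelSpace X]
    (T : X → X) (hT : Continuous T)
    (μ : Measure X) [IsProbabilityMeasure μ] (hμ : Ergodic T μ)
    (𝒜 : Set (Set X)) (hfin : 𝒜.Finite)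
    (hpart : ∀ x : X, ∃! A, A ∈ 𝒜 ∧ x ∈ A)
    (hmeas : ∀ A ∈ 𝒜, MeasurableSet A)
    (hbd : ∀ A ∈ 𝒜, μ (frontier A) = 0) :
    ∀ δ : ℝ, 0 < δ → ∃ N : ℕ, ∃ ε₁ > (0 : ℝ), ∃ D : Set X, MeasurableSet D ∧
      1 - δ < (μ D).toReal ∧
      ∀ ε : ℝ, 0 < ε → ε < ε₁ → ∀ x ∈ D, ∀ n : ℕ, N ≤ n →
        (({A ∈ joinCyl T 𝒜 n | (A ∩ bowenBall T ε n x).Nonempty}).ncard : ℝ)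
          ≤ Real.exp (δ * n) := by
  intro δ hδ
  set L : ℝ := Real.log hfin.toFinset.card with hL
  have hL0 : 0 ≤ L := Real.log_natCast_nonneg _
  have hη : 0 < δ / (L + 1) := by positivity
  obtain ⟨ε₁, hε₁, hUm, hU⟩ := exists_badSet_small μ 𝒜 hfin hpart hbd (mul_pos hδ hη)
  obtain ⟨D, hDm, hDμ, hD⟩ := exists_good_set hμ.toMeasurePreserving hUm hη hU
  refine ⟨0, ε₁, hε₁, D, hDm, hDμ, fun ε _ hε x hx n _ => ?_⟩
  refine (count_bound T 𝒜 hfin hpart hε x n).trans (Real.exp_le_exp.2 ?_)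
  refine (mul_le_mul_of_nonneg_left (hD x hx n) hL0).trans ?_
  rw [← mul_assoc]
  refine mul_le_mul_of_nonneg_right ?_ (Nat.cast_nonneg n)
  rw [mul_div_assoc', div_le_iff₀ (by positivity)]
  nlinarith
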